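/- Weighted interpolation against L^∞: Let m ≥ 2 be an integer and σ_m > −1/2 with m − σ_m − d/2 > 0. For 0 < j < m set θ_j = j/m, 1/p_j = θ_j/2, σ_j = σ_m θ_j. Then there is a constant C such that for every f smooth on the closed half-space and compactly supported, ‖x_d^{σ_j} |∂^j f| ‖_{L^{p_j}(H)} ≤ C ‖f‖_{L^∞(H)}^{1−θ_j} ‖x_d^{σ_m} |∂^m f| ‖_{L^{2}(H)}^{θ_j}, where |∂^k f| denotes the norm of the full k-th derivative of f. -/

import Mathlib

open MeasureTheory Set ENNReal

noncomputable section

/-- The half-space `H = {x ∈ ℝ^{d+1} : x_last > 0}`. -/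
def HS (d : ℕ) : Set (Fin (d + 1) → ℝ) := {x | 0 < x (Fin.last d)}

/-- The weighted Lebesgue norm `‖x_d^σ g‖_{L^p(H)}`. -/
def wLp (d : ℕ) (σ : ℝ) (p : ℝ≥0∞) (g : (Fin (d + 1) → ℝ) → ℝ) : ℝ≥0∞ :=
  eLpNorm (fun x => x (Fin.last d) ^ σ * g x) p (volume.restrict (HS d))

/-- The coefficients of a polynomial of degree less than `m` are controlled, scale by scale, by its
values on `[0, L]`. -/
lemma exists_coeff_bound (m : ℕ) : ∃ C : ℝ, 0 < C ∧ ∀ (c : ℕ → ℝ) (L B : ℝ), 0 < L →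
    (∀ u ∈ Icc 0 L, |∑ i ∈ Finset.range m, c i * u ^ i| ≤ B) →
    ∀ i < m, |c i| * L ^ i ≤ C * B := by
  set V : Matrix (Fin m) (Fin m) ℝ := Matrix.vandermonde (fun k : Fin m => (k : ℝ) / m) with hV
  have hdet : IsUnit V.det := by
    rw [isUnit_iff_ne_zero, hV, Matrix.det_vandermonde_ne_zero_iff]
    intro k l hkl
    have hm : (0 : ℝ) < m := by exact_mod_cast (Fin.pos k)
    have h : (k : ℝ) = l := by simpa [div_left_inj' hm.ne'] using hkl
    exact Fin.ext (by exact_mod_cast h)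
  refine ⟨1 + ∑ i, ∑ k, |V⁻¹ i k|, by positivity, fun c L B hL h i hi => ?_⟩
  have hB : 0 ≤ B := (abs_nonneg _).trans (h 0 ⟨le_rfl, hL.le⟩)
  set w : Fin m → ℝ := fun i => c i * L ^ (i : ℕ) with hw
  have hval : ∀ k, |(V.mulVec w) k| ≤ B := by
    intro k
    have hm : (0 : ℝ) < m := by exact_mod_cast (Fin.pos k)
    have hk : (k : ℝ) ≤ m := by exact_mod_cast k.2.le
    have hu : L * ((k : ℝ) / m) ∈ Icc 0 L :=
      ⟨by positivity, mul_le_of_le_one_right hL.le ((div_le_one hm).2 hk)⟩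
    convert h _ hu using 2
    rw [Finset.sum_range, Matrix.mulVec, dotProduct]
    refine Finset.sum_congr rfl fun x _ => ?_
    simp only [hV, hw, Matrix.vandermonde_apply, mul_pow]
    ring
  have hinv : w = V⁻¹.mulVec (V.mulVec w) := by
    rw [Matrix.mulVec_mulVec, Matrix.nonsing_inv_mul _ hdet, Matrix.one_mulVec]
  have hwi : |w ⟨i, hi⟩| ≤ ∑ k, |V⁻¹ ⟨i, hi⟩ k| * B := by
    rw [hinv, Matrix.mulVec, dotProduct]
    refine (Finset.abs_sum_le_sum_abs _ _).trans (Finset.sum_le_sum fun k _ => ?_)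
    rw [abs_mul]
    gcongr
    exact hval k
  calc |c i| * L ^ i = |w ⟨i, hi⟩| := by simp [hw, abs_mul, abs_of_pos hL]
    _ ≤ (∑ k, |V⁻¹ ⟨i, hi⟩ k|) * B := by rw [Finset.sum_mul]; exact hwi
    _ ≤ _ := by
      gcongr
      have := Finset.single_le_sum (f := fun i => ∑ k, |V⁻¹ i k|)
        (fun i _ => by positivity) (Finset.mem_univ (⟨i, hi⟩ : Fin m))
      exact this.trans (le_add_of_nonneg_left zero_le_one)

/-- Taylor's formula for a chain of successive derivatives, with an `L¹` bound of the remainder. -/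
lemma taylor_remainder_bound (n : ℕ) : ∀ (G : ℕ → ℝ → ℝ),
    (∀ k t, HasDerivAt (G k) (G (k + 1) t) t) → ∀ t L u : ℝ, u ∈ Icc 0 L →
    |G 0 (t + u) - ∑ i ∈ Finset.range (n + 1), G i t / i.factorial * u ^ i|
      ≤ L ^ n * ∫ s in t..(t + L), |G (n + 1) s| := by
  induction n with
  | zero =>
    intro G hG t L u hu
    have hc : Continuous (G 1) := continuous_iff_continuousAt.2 fun x => (hG 1 x).continuousAt
    have hint : ∫ s in t..(t + u), G 1 s = G 0 (t + u) - G 0 t :=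
      intervalIntegral.integral_eq_sub_of_hasDerivAt (fun x _ => hG 0 x)
        (hc.intervalIntegrable _ _)
    simp only [zero_add, Finset.range_one, Finset.sum_singleton, Nat.factorial_zero, Nat.cast_one,
      div_one, pow_zero, mul_one, one_mul]
    rw [← hint]
    refine (intervalIntegral.norm_integral_le_integral_norm (f := G 1)
      (by linarith [hu.1])).trans ?_
    exact intervalIntegral.integral_mono_interval le_rfl (by linarith [hu.1]) (by linarith [hu.2])
      (Filter.Eventually.of_forall fun _ => abs_nonneg _) (hc.abs.intervalIntegrable _ _)
  | succ n ih =>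
    intro G hG t L u hu
    set I := ∫ s in t..(t + L), |G (n + 2) s|
    have hder : ∀ x ∈ Icc 0 L, HasDerivWithinAt
        (fun u => G 0 (t + u) - ∑ i ∈ Finset.range (n + 2), G i t / i.factorial * u ^ i)
        (G 1 (t + x) - ∑ i ∈ Finset.range (n + 1), G (i + 1) t / i.factorial * x ^ i)
        (Icc 0 L) x := by
      intro x _
      refine HasDerivAt.hasDerivWithinAt ?_
      refine HasDerivAt.sub ((hG 0 (t + x)).comp_const_add t x) ?_
      have hs : ∀ i ∈ Finset.range (n + 2), HasDerivAt
          (fun u : ℝ => G i t / i.factorial * u ^ i)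
          (G i t / i.factorial * (i * x ^ (i - 1))) x :=
        fun i _ => (hasDerivAt_pow i x).const_mul _
      convert! HasDerivAt.fun_sum hs using 1
      rw [Finset.sum_range_succ' _ (n + 1)]
      simp only [Nat.cast_zero, zero_mul, mul_zero, add_zero]
      refine Finset.sum_congr rfl fun i _ => ?_
      have h1 : ((i : ℝ) + 1) ≠ 0 := by positivity
      have h2 : (i.factorial : ℝ) ≠ 0 := by positivity
      rw [Nat.factorial_succ, Nat.add_sub_cancel]
      push_cast
      field_simp
    have hb : ∀ x ∈ Ico 0 L,
        ‖G 1 (t + x) - ∑ i ∈ Finset.range (n + 1), G (i + 1) t / i.factorial * x ^ i‖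
          ≤ L ^ n * I :=
      fun x hx => ih (fun k => G (k + 1)) (fun k => hG (k + 1)) t L x ⟨hx.1, hx.2.le⟩
    have hL : 0 ≤ L := hu.1.trans hu.2
    have hI : 0 ≤ I := intervalIntegral.integral_nonneg (by linarith) fun _ _ => abs_nonneg _
    have := norm_image_sub_le_of_norm_deriv_le_segment' hder hb u hu
    have h0 : G 0 (t + 0) - ∑ i ∈ Finset.range (n + 2), G i t / i.factorial * (0 : ℝ) ^ i = 0 := by
      rw [Finset.sum_range_succ']
      simp
    rw [h0, sub_zero, sub_zero, Real.norm_eq_abs] at this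
    refine this.trans ?_
    rw [pow_succ, mul_right_comm]
    gcongr
    exact hu.2

/-- Local interpolation at scale `ℓ`: if the weighted `L²` mass of the top derivative on
`[t, t + ℓ]` is at most `M²`, the lower derivatives at `t` obey the bounds dictated by scaling. -/
lemma exists_local_bound (m : ℕ) (hm : 0 < m) : ∃ C : ℝ, 0 < C ∧ ∀ (G : ℕ → ℝ → ℝ),
    (∀ k t, HasDerivAt (G k) (G (k + 1) t) t) → ∀ M t ℓ : ℝ, 0 < M → 0 < t → 0 < ℓ →
    (∀ s, 0 < s → |G 0 s| ≤ M) →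
    ∫ s in t..(t + ℓ), (t + ℓ - s) ^ (2 * m - 1) * G m s ^ 2 ≤ M ^ 2 →
    ∀ j < m, |G j t| ≤ C * M / ℓ ^ j := by
  obtain ⟨C, hC, hpoly⟩ := exists_coeff_bound m
  refine ⟨m.factorial * (C * 2) * 2 ^ m, by positivity, fun G hG M t ℓ hM ht hℓ h0 hK j hj => ?_⟩
  obtain ⟨n, rfl⟩ : ∃ n, m = n + 1 := ⟨m - 1, by omega⟩
  have hc : Continuous (G (n + 1)) :=
    continuous_iff_continuousAt.2 fun x => (hG (n + 1) x).continuousAt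
  have hexp : 2 * (n + 1) - 1 = 2 * n + 1 := by omega
  rw [hexp] at hK
  set L := ℓ / 2 with hLdef
  have hL : 0 < L := by positivity
  have hmass : L ^ (2 * n + 1) * ∫ s in t..(t + L), G (n + 1) s ^ 2 ≤ M ^ 2 := by
    refine le_trans ?_ hK
    rw [← intervalIntegral.integral_const_mul]
    refine le_trans (intervalIntegral.integral_mono_on (by linarith)
      (Continuous.intervalIntegrable (by fun_prop) _ _)
      (Continuous.intervalIntegrable (by fun_prop) _ _)
      (g := fun s => (t + ℓ - s) ^ (2 * n + 1) * G (n + 1) s ^ 2) fun s hs => ?_) ?_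
    · gcongr
      linarith [hs.2]
    · refine intervalIntegral.integral_mono_interval le_rfl (by linarith) (by linarith)
        ?_ (Continuous.intervalIntegrable (by fun_prop) _ _)
      filter_upwards [ae_restrict_mem measurableSet_Ioc] with s hs
      have : 0 ≤ t + ℓ - s := by linarith [hs.2]
      simp only [Pi.zero_apply]
      positivity
  have hI : L ^ n * ∫ s in t..(t + L), |G (n + 1) s| ≤ M := by
    set J := ∫ s in t..(t + L), G (n + 1) s ^ 2 with hJ
    have h1 : ∫ s in t..(t + L), |G (n + 1) s| ≤
        ∫ s in t..(t + L), (L ^ (n + 1) / (2 * M) * G (n + 1) s ^ 2 + M / (2 * L ^ (n + 1))) := by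
      refine intervalIntegral.integral_mono_on (by linarith)
        (Continuous.intervalIntegrable (by fun_prop) _ _)
        (Continuous.intervalIntegrable (by fun_prop) _ _) fun s _ => ?_
      have h2 : L ^ (n + 1) / (2 * M) * G (n + 1) s ^ 2 + M / (2 * L ^ (n + 1)) - |G (n + 1) s|
          = (L ^ (n + 1) * |G (n + 1) s| - M) ^ 2 / (2 * M * L ^ (n + 1)) := by
        rw [← sq_abs (G (n + 1) s)]
        field_simp
        ring
      have h3 : 0 ≤ (L ^ (n + 1) * |G (n + 1) s| - M) ^ 2 / (2 * M * L ^ (n + 1)) := by positivity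
      linarith
    rw [intervalIntegral.integral_add (Continuous.intervalIntegrable (by fun_prop) _ _)
      (Continuous.intervalIntegrable (by fun_prop) _ _), intervalIntegral.integral_const_mul,
      intervalIntegral.integral_const, ← hJ, add_sub_cancel_left, smul_eq_mul] at h1
    calc L ^ n * ∫ s in t..(t + L), |G (n + 1) s|
        ≤ L ^ n * (L ^ (n + 1) / (2 * M) * J + L * (M / (2 * L ^ (n + 1)))) := by gcongr
      _ = (L ^ (2 * n + 1) * J) / (2 * M) + M / 2 := by
        field_simp
        ring
      _ ≤ M ^ 2 / (2 * M) + M / 2 := by gcongr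
      _ = M := by field_simp; ring
  have hP : ∀ u ∈ Icc 0 L,
      |∑ i ∈ Finset.range (n + 1), G i t / i.factorial * u ^ i| ≤ 2 * M := by
    intro u hu
    have h1 := taylor_remainder_bound n G hG t L u hu
    have h2 := h0 (t + u) (by linarith [hu.1])
    rw [abs_le] at *
    constructor <;> linarith
  have h3 := hpoly (fun i => G i t / i.factorial) L (2 * M) hL hP j hj
  rw [abs_div, Nat.abs_cast] at h3
  have hf : (0 : ℝ) < j.factorial := by positivity
  have h4 : |G j t| ≤ j.factorial * (C * 2) * 2 ^ j * M / ℓ ^ j := by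
    rw [le_div_iff₀ (by positivity)]
    have h5 : ℓ ^ j = 2 ^ j * L ^ j := by rw [← mul_pow, hLdef]; congr 1; ring
    calc |G j t| * ℓ ^ j = (|G j t| / j.factorial * L ^ j) * (j.factorial * 2 ^ j) := by
          rw [h5]; field_simp
      _ ≤ (C * (2 * M)) * (j.factorial * 2 ^ j) := by gcongr
      _ = _ := by ring
  refine h4.trans ?_
  gcongr
  norm_num

/-- A one-sided maximal kernel with monotone scale `ε` has bounded integral. -/
lemma lintegral_monotone_scale_kernel_le {s : ℝ} {A : Set ℝ} (hA : A ⊆ Ioo 0 s) {ε : ℝ → ℝ}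
    (hε : ∀ t ∈ A, 0 < ε t) (hmono : MonotoneOn ε A) :
    ∫⁻ t in A, ENNReal.ofReal (ε t / (ε t + (s - t)) ^ 2) ≤ 2 := by
  set B := {t ∈ A | s - t ≤ ε t} with hB
  set N := {t ∈ A | ε t < s - t} with hN
  have hAB : A = B ∪ N := by
    ext t
    refine ⟨fun h => ?_, fun h => h.elim And.left And.left⟩
    exact (le_or_gt (s - t) (ε t)).imp (And.intro h) (And.intro h)
  have hBle : ∫⁻ t in B, ENNReal.ofReal (ε t / (ε t + (s - t)) ^ 2) ≤ 1 := by
    rcases B.eq_empty_or_nonempty with hBe | hBn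
    · simp [hBe]
    have hbdd : BddBelow B := ⟨0, fun t ht => (hA ht.1).1.le⟩
    set r := s - sInf B with hr
    have hrε : ∀ t ∈ B, r ≤ ε t := by
      intro t ht
      have : s - ε t ≤ sInf B := by
        refine le_csInf hBn fun t₁ ht₁ => ?_
        rcases le_total t₁ t with h | h
        · linarith [ht₁.2, hmono ht₁.1 ht.1 h]
        · linarith [ht.2]
      linarith
    have hr0 : 0 < r := by
      obtain ⟨t, ht⟩ := hBn
      linarith [csInf_le hbdd ht, (hA ht.1).2]
    calc ∫⁻ t in B, ENNReal.ofReal (ε t / (ε t + (s - t)) ^ 2)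
        ≤ ∫⁻ _ in B, ENNReal.ofReal (1 / r) := by
          refine setLIntegral_mono measurable_const fun t ht => ENNReal.ofReal_le_ofReal ?_
          have h1 := hrε t ht
          have h2 := (hA ht.1).2
          rw [div_le_div_iff₀ (by nlinarith) hr0]
          nlinarith
      _ ≤ ∫⁻ _ in Icc (sInf B) s, ENNReal.ofReal (1 / r) :=
          lintegral_mono_set fun t ht => ⟨csInf_le hbdd ht, (hA ht.1).2.le⟩
      _ = 1 := by
          rw [setLIntegral_const, Real.volume_Icc, ← ENNReal.ofReal_mul (by positivity), ← hr]
          rw [one_div_mul_cancel hr0.ne', ENNReal.ofReal_one]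
  have hNle : ∫⁻ t in N, ENNReal.ofReal (ε t / (ε t + (s - t)) ^ 2) ≤ 1 := by
    rcases N.eq_empty_or_nonempty with hNe | hNn
    · simp [hNe]
    have hbdd : BddAbove N := ⟨s, fun t ht => (hA ht.1).2.le⟩
    set r := s - sSup N with hr
    have hrε : ∀ t ∈ N, ε t ≤ r := by
      intro t ht
      have : sSup N ≤ s - ε t := by
        refine csSup_le hNn fun t₁ ht₁ => ?_
        rcases le_total t t₁ with h | h
        · linarith [ht₁.2, hmono ht.1 ht₁.1 h]
        · linarith [ht.2]
      linarith
    obtain ⟨t₀, ht₀⟩ := hNn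
    have hr0 : 0 < r := (hε t₀ ht₀.1).trans_le (hrε t₀ ht₀)
    have hrs : 0 < sSup N := (hA ht₀.1).1.trans_le (le_csSup hbdd ht₀)
    have hs : 0 < s := by linarith
    have hderiv : ∀ t ∈ uIcc 0 (sSup N), HasDerivAt (fun t => r / (s - t)) (r / (s - t) ^ 2) t := by
      intro t ht
      rw [uIcc_of_le hrs.le] at ht
      have h1 : s - t ≠ 0 := by
        have := ht.2
        intro h; linarith
      have := (hasDerivAt_const t r).div ((hasDerivAt_id t).const_sub s) h1
      convert! this using 1
      simp
    have hcont : ContinuousOn (fun t => r / (s - t) ^ 2) (uIcc 0 (sSup N)) := by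
      refine continuousOn_const.div (by fun_prop) fun t ht => ?_
      rw [uIcc_of_le hrs.le] at ht
      have h1 : 0 < s - t := by linarith [ht.2]
      positivity
    calc ∫⁻ t in N, ENNReal.ofReal (ε t / (ε t + (s - t)) ^ 2)
        ≤ ∫⁻ t in N, ENNReal.ofReal (r / (s - t) ^ 2) := by
          refine setLIntegral_mono (by fun_prop) fun t ht => ENNReal.ofReal_le_ofReal ?_
          have h1 := hrε t ht
          have h2 := hε t ht.1
          have h3 : 0 < s - t := h2.trans ht.2
          gcongr
          linarith
      _ ≤ ∫⁻ t in Ioc 0 (sSup N), ENNReal.ofReal (r / (s - t) ^ 2) :=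
          lintegral_mono_set fun t ht => ⟨(hA ht.1).1, le_csSup hbdd ht⟩
      _ = ENNReal.ofReal (∫ t in 0..sSup N, r / (s - t) ^ 2) := by
          rw [intervalIntegral.integral_of_le hrs.le, ofReal_integral_eq_lintegral_ofReal]
          · exact hcont.intervalIntegrable.1
          · exact Filter.Eventually.of_forall fun t => by
              simp only [Pi.zero_apply]
              positivity
      _ ≤ 1 := by
          rw [intervalIntegral.integral_eq_sub_of_hasDerivAt hderiv hcont.intervalIntegrable,
            ← hr, div_self hr0.ne', sub_zero]
          exact ENNReal.ofReal_le_one.2 (by linarith [div_pos hr0 hs])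
  rw [hAB]
  calc _ ≤ _ := lintegral_union_le _ _ _
    _ ≤ 1 + 1 := add_le_add hBle hNle
    _ = 2 := one_add_one_eq_two

/-- Weighted version of `lintegral_monotone_scale_kernel_le` for the power weights `t ^ a`,
`a > -1`. -/
lemma exists_weighted_kernel_bound {a : ℝ} (ha : -1 < a) : ∃ C : ℝ, 0 < C ∧
    ∀ (s : ℝ) (A : Set ℝ) (ε : ℝ → ℝ), 0 < s → A ⊆ Ioo 0 s → (∀ t ∈ A, 0 < ε t) →
    MonotoneOn ε A →
    ∫⁻ t in A, ENNReal.ofReal (t ^ a) * ENNReal.ofReal (ε t / (ε t + (s - t)) ^ 2)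
      ≤ ENNReal.ofReal (C * s ^ a) := by
  have ha1 : 0 < a + 1 := by linarith
  refine ⟨2 ^ |a| * 2 + 2 ^ (-a) / (a + 1), by positivity, fun s A ε hs hA hε hmono => ?_⟩
  have hnear : ∫⁻ t in A ∩ Ici (s / 2),
      ENNReal.ofReal (t ^ a) * ENNReal.ofReal (ε t / (ε t + (s - t)) ^ 2)
      ≤ ENNReal.ofReal (2 ^ |a| * 2 * s ^ a) := by
    have hw : ∀ t ∈ Ico (s / 2) s, t ^ a ≤ 2 ^ |a| * s ^ a := by
      intro t ht
      have ht0 : 0 < t := (half_pos hs).trans_le ht.1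
      have hts := ht.2
      rcases le_total 0 a with h | h
      · calc t ^ a ≤ s ^ a := by gcongr
          _ ≤ 2 ^ |a| * s ^ a := le_mul_of_one_le_left (by positivity)
              (Real.one_le_rpow one_le_two (abs_nonneg a))
      · calc t ^ a ≤ (s / 2) ^ a := Real.rpow_le_rpow_of_nonpos (by positivity) ht.1 h
          _ = 2 ^ |a| * s ^ a := by
            rw [Real.div_rpow hs.le zero_le_two, abs_of_nonpos h, Real.rpow_neg zero_le_two]
            field_simp
    calc _ ≤ ∫⁻ t in A ∩ Ici (s / 2), ENNReal.ofReal (2 ^ |a| * s ^ a) *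
          ENNReal.ofReal (ε t / (ε t + (s - t)) ^ 2) := by
          refine lintegral_mono_ae ?_
          have hsub : A ∩ Ici (s / 2) ⊆ Ico (s / 2) s := fun t ht => ⟨ht.2, (hA ht.1).2⟩
          filter_upwards [ae_mono (Measure.restrict_mono hsub le_rfl)
            (ae_restrict_mem measurableSet_Ico)] with t ht
          gcongr
          exact hw t ht
      _ = ENNReal.ofReal (2 ^ |a| * s ^ a) * ∫⁻ t in A ∩ Ici (s / 2),
          ENNReal.ofReal (ε t / (ε t + (s - t)) ^ 2) :=
          lintegral_const_mul' _ _ ENNReal.ofReal_ne_top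
      _ ≤ ENNReal.ofReal (2 ^ |a| * s ^ a) * 2 := by
          gcongr
          exact lintegral_monotone_scale_kernel_le (inter_subset_left.trans hA)
            (fun t ht => hε t ht.1) (hmono.mono inter_subset_left)
      _ = _ := by
          rw [← ENNReal.ofReal_ofNat 2, ← ENNReal.ofReal_mul (by positivity)]
          congr 1; ring
  have hfar : ∫⁻ t in A ∩ Iio (s / 2),
      ENNReal.ofReal (t ^ a) * ENNReal.ofReal (ε t / (ε t + (s - t)) ^ 2)
      ≤ ENNReal.ofReal (2 ^ (-a) / (a + 1) * s ^ a) := by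
    have hs2 : 0 ≤ s / 2 := by positivity
    calc _ ≤ ∫⁻ t in A ∩ Iio (s / 2), ENNReal.ofReal (t ^ a) * ENNReal.ofReal (2 / s) := by
          refine setLIntegral_mono (by fun_prop) fun t ht => ?_
          refine mul_le_mul_right (ENNReal.ofReal_le_ofReal ?_) _
          have h1 := hε t ht.1
          have h2 : t < s / 2 := ht.2
          rw [div_le_div_iff₀ (by nlinarith) hs]
          nlinarith
      _ ≤ ∫⁻ t in Ioc 0 (s / 2), ENNReal.ofReal (t ^ a) * ENNReal.ofReal (2 / s) :=
          lintegral_mono_set fun t ht => ⟨(hA ht.1).1, le_of_lt ht.2⟩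
      _ = ENNReal.ofReal (∫ t in 0..(s / 2), t ^ a) * ENNReal.ofReal (2 / s) := by
          rw [lintegral_mul_const' _ _ ENNReal.ofReal_ne_top, intervalIntegral.integral_of_le hs2,
            ofReal_integral_eq_lintegral_ofReal]
          · exact (intervalIntegral.intervalIntegrable_rpow' ha).1
          · filter_upwards [ae_restrict_mem measurableSet_Ioc] with t ht
            exact Real.rpow_nonneg ht.1.le _
      _ ≤ _ := by
          rw [integral_rpow (Or.inl ha), Real.zero_rpow ha1.ne', sub_zero,
            ← ENNReal.ofReal_mul (by positivity)]
          refine le_of_eq (congrArg _ ?_)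
          rw [Real.rpow_add (by positivity), Real.rpow_one, Real.div_rpow hs.le zero_le_two,
            Real.rpow_neg zero_le_two]
          field_simp
  have hsplit : A = (A ∩ Ici (s / 2)) ∪ (A ∩ Iio (s / 2)) := by
    rw [← inter_union_distrib_left, Ici_union_Iio, inter_univ]
  rw [hsplit]
  refine (lintegral_union_le _ _ _).trans ((add_le_add hnear hfar).trans ?_)
  rw [← ENNReal.ofReal_add (by positivity) (by positivity), add_mul]

/-- Weighted Gagliardo–Nirenberg inequality against `L^∞` on the half-line. -/
lemma exists_halfline_bound {a : ℝ} (ha : -1 < a) {m j : ℕ} (hj : 0 < j) (hjm : j < m) :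
    ∃ C : ℝ, 0 < C ∧ ∀ (G : ℕ → ℝ → ℝ), (∀ k t, HasDerivAt (G k) (G (k + 1) t) t) →
    ∀ M : ℝ, 0 < M → (∀ s, 0 < s → |G 0 s| ≤ M) →
    ∫⁻ t in Ioi 0, ENNReal.ofReal (t ^ a * |G j t| ^ (2 * (m : ℝ) / j))
      ≤ ENNReal.ofReal (C * M ^ (2 * (m : ℝ) / j - 2)) *
        ∫⁻ t in Ioi 0, ENNReal.ofReal (t ^ a * G m t ^ 2) := by
  obtain ⟨C₁, hC₁, hloc⟩ := exists_local_bound m (by omega)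
  obtain ⟨C₂, hC₂, hker⟩ := exists_weighted_kernel_bound ha
  set p : ℝ := 2 * (m : ℝ) / j with hp
  have hj0 : (0 : ℝ) < j := by exact_mod_cast hj
  have hm0 : (0 : ℝ) < m := by exact_mod_cast hj.trans hjm
  have hp0 : 0 < p := by positivity
  refine ⟨C₁ ^ p * C₂, by positivity, fun G hG M hM h0 => ?_⟩
  have hc : Continuous (G m) := continuous_iff_continuousAt.2 fun x => (hG m x).continuousAt
  obtain ⟨k, hk⟩ : ∃ k, 2 * m - 1 = k + 1 := ⟨2 * m - 2, by omega⟩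
  have hk2 : 2 * m = k + 2 := by omega
  rw [hk] at hloc
  set K : ℝ → ℝ → ℝ := fun t e => ∫ s in t..e, (e - s) ^ (k + 1) * G m s ^ 2 with hKdef
  have hKcont : ∀ t, Continuous (K t) := fun t =>
    intervalIntegral.continuous_parametric_intervalIntegral_of_continuous
      (f := fun e s => (e - s) ^ (k + 1) * G m s ^ 2)
      (by simp only [Function.uncurry_def]; fun_prop) continuous_id
  have hKint : ∀ t u e, IntervalIntegrable (fun s => (e - s) ^ (k + 1) * G m s ^ 2) volume t u :=
    fun t u e => Continuous.intervalIntegrable (by fun_prop) _ _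
  have hKanti : ∀ t t' e, t ≤ t' → t' ≤ e → K t' e ≤ K t e := by
    intro t t' e htt' he
    refine intervalIntegral.integral_mono_interval htt' he le_rfl ?_ (hKint _ _ _)
    filter_upwards [ae_restrict_mem measurableSet_Ioc] with s hs
    have : 0 ≤ e - s := by linarith [hs.2]
    simp only [Pi.zero_apply]
    positivity
  set S : ℝ → Set ℝ := fun t => {e | t ≤ e ∧ M ^ 2 ≤ K t e} with hS
  have hSanti : ∀ t t', t ≤ t' → S t' ⊆ S t := fun t t' htt' e he =>
    ⟨htt'.trans he.1, he.2.trans (hKanti t t' e htt' he.1)⟩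
  have hSbdd : ∀ t, BddBelow (S t) := fun t => ⟨t, fun e he => he.1⟩
  have hSclosed : ∀ t, IsClosed (S t) := fun t =>
    (isClosed_le continuous_const continuous_id).inter
      (isClosed_le continuous_const (hKcont t))
  set U : Set ℝ := {t | 0 < t ∧ (S t).Nonempty} with hU
  have hUmeas : MeasurableSet U := by
    refine OrdConnected.measurableSet ⟨fun t ht t' ht' x hx => ?_⟩
    exact ⟨ht.1.trans_le hx.1, ht'.2.mono (hSanti _ _ hx.2)⟩
  set e : ℝ → ℝ := fun t => sInf (S t) with he
  have hemem : ∀ t ∈ U, e t ∈ S t := fun t ht => (hSclosed t).csInf_mem ht.2 (hSbdd t)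
  have hemono : MonotoneOn e U := fun t ht t' ht' htt' =>
    csInf_le_csInf (hSbdd t) ht'.2 (hSanti t t' htt')
  have hKself : ∀ t, K t t = 0 := fun t => intervalIntegral.integral_same
  have hte : ∀ t ∈ U, t < e t := by
    intro t ht
    refine lt_of_le_of_ne (hemem t ht).1 fun h => ?_
    have h1 := (hemem t ht).2
    rw [← h, hKself] at h1
    have : 0 < M ^ 2 := by positivity
    linarith
  have hKe : ∀ t ∈ U, K t (e t) = M ^ 2 := by
    intro t ht
    obtain ⟨e', he', hKe'⟩ := intermediate_value_Icc (hte t ht).le (hKcont t).continuousOn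
      (show M ^ 2 ∈ Icc (K t t) (K t (e t)) from
        ⟨by rw [hKself]; positivity, (hemem t ht).2⟩)
    have h1 : e t ≤ e' := csInf_le (hSbdd t) ⟨he'.1, hKe'.ge⟩
    rw [le_antisymm h1 he'.2, hKe']
  have hzero : ∀ t, 0 < t → t ∉ U → G j t = 0 := by
    intro t ht htU
    have h1 : ∀ ℓ, 0 < ℓ → |G j t| ≤ C₁ * M / ℓ ^ j := by
      intro ℓ hℓ
      refine hloc G hG M t ℓ hM ht hℓ h0 ?_ j hjm
      by_contra hcon
      exact htU ⟨ht, t + ℓ, by linarith, (not_le.1 hcon).le⟩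
    have h2 : Filter.Tendsto (fun ℓ : ℝ => C₁ * M / ℓ ^ j) Filter.atTop (nhds 0) :=
      (Filter.tendsto_pow_atTop hj.ne').const_div_atTop _
    have h3 : |G j t| ≤ 0 := ge_of_tendsto h2
      (by filter_upwards [Filter.eventually_gt_atTop 0] with ℓ hℓ using h1 ℓ hℓ)
    exact abs_nonpos_iff.1 h3
  have hbound : ∀ t ∈ U, |G j t| ^ p ≤
      C₁ ^ p * M ^ (p - 2) * (K t (e t) / (e t - t) ^ (k + 2)) := by
    intro t ht
    have hℓ : 0 < e t - t := sub_pos.2 (hte t ht)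
    have h1 : |G j t| ≤ C₁ * M / (e t - t) ^ j := by
      refine hloc G hG M t (e t - t) hM ht.1 hℓ h0 ?_ j hjm
      rw [add_sub_cancel]
      exact (hKe t ht).le
    calc |G j t| ^ p ≤ (C₁ * M / (e t - t) ^ j) ^ p := by gcongr
      _ = C₁ ^ p * M ^ p / (e t - t) ^ (k + 2) := by
        rw [Real.div_rpow (by positivity) (by positivity), Real.mul_rpow hC₁.le hM.le,
          ← Real.rpow_natCast _ j, ← Real.rpow_mul hℓ.le, hp, mul_div_cancel₀ _ hj0.ne', ← hk2,
          ← Real.rpow_natCast _ (2 * m)]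
        push_cast
        rfl
      _ = _ := by
        rw [hKe t ht, Real.rpow_sub hM, Real.rpow_two]
        field_simp
  set F : ℝ → ℝ → ℝ≥0∞ := fun t s => if t < s ∧ s < e t then
    ENNReal.ofReal (t ^ a) * ENNReal.ofReal ((e t - s) / (e t - t) ^ 2) *
      ENNReal.ofReal (G m s ^ 2) else 0 with hF
  have hFmeas : AEMeasurable (Function.uncurry F)
      ((volume.restrict U).prod (volume.restrict (Ioi 0))) := by
    have h1 : AEMeasurable (fun q : ℝ × ℝ => (e q.1, q))
        ((volume.restrict U).prod (volume.restrict (Ioi 0))) :=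
      (aemeasurable_restrict_of_monotoneOn hUmeas hemono).comp_fst.prodMk aemeasurable_id
    have h2 : Measurable (fun q : ℝ × ℝ × ℝ => if q.2.1 < q.2.2 ∧ q.2.2 < q.1 then
        ENNReal.ofReal (q.2.1 ^ a) * ENNReal.ofReal ((q.1 - q.2.2) / (q.1 - q.2.1) ^ 2) *
          ENNReal.ofReal (G m q.2.2 ^ 2) else 0) := by
      refine Measurable.ite ?_ (by fun_prop) measurable_const
      exact (measurableSet_lt (f := fun q : ℝ × ℝ × ℝ => q.2.1) (g := fun q => q.2.2)
        (by fun_prop) (by fun_prop)).inter (measurableSet_lt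
        (f := fun q : ℝ × ℝ × ℝ => q.2.2) (g := fun q => q.1) (by fun_prop) (by fun_prop))
    exact h2.comp_aemeasurable h1
  have hpt : ∀ t ∈ U, ENNReal.ofReal (t ^ a * |G j t| ^ p) ≤
      ENNReal.ofReal (C₁ ^ p * M ^ (p - 2)) * ∫⁻ s in Ioi 0, F t s := by
    intro t ht
    have hℓ : 0 < e t - t := sub_pos.2 (hte t ht)
    have hta : 0 ≤ t ^ a := Real.rpow_nonneg ht.1.le _
    have hKl : ENNReal.ofReal (K t (e t)) =
        ∫⁻ s in Ioo t (e t), ENNReal.ofReal ((e t - s) ^ (k + 1) * G m s ^ 2) := by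
      rw [hKdef]
      simp only
      rw [intervalIntegral.integral_of_le (hte t ht).le, ofReal_integral_eq_lintegral_ofReal
        (hKint _ _ _).1, Measure.restrict_congr_set Ioo_ae_eq_Ioc]
      filter_upwards [ae_restrict_mem measurableSet_Ioc] with s hs
      have : 0 ≤ e t - s := by linarith [hs.2]
      simp only [Pi.zero_apply]
      positivity
    calc ENNReal.ofReal (t ^ a * |G j t| ^ p)
        ≤ ENNReal.ofReal (t ^ a *
            (C₁ ^ p * M ^ (p - 2) * (K t (e t) / (e t - t) ^ (k + 2)))) := by
          gcongr
          exact hbound t ht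
      _ = ENNReal.ofReal (C₁ ^ p * M ^ (p - 2)) *
          (ENNReal.ofReal (t ^ a / (e t - t) ^ (k + 2)) * ENNReal.ofReal (K t (e t))) := by
          rw [← ENNReal.ofReal_mul (by positivity), ← ENNReal.ofReal_mul (by positivity)]
          congr 1
          ring
      _ ≤ _ := by
          gcongr
          rw [hKl, ← lintegral_const_mul' _ _ ENNReal.ofReal_ne_top]
          refine le_trans ?_ (lintegral_mono_set (fun s hs => ht.1.trans hs.1 :
            Ioo t (e t) ⊆ Ioi 0))
          refine setLIntegral_mono' measurableSet_Ioo fun s hs => ?_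
          simp only [hF]
          rw [if_pos (show t < s ∧ s < e t from hs), ← ENNReal.ofReal_mul (by positivity),
            ← ENNReal.ofReal_mul hta,
            ← ENNReal.ofReal_mul (mul_nonneg hta (div_nonneg (by linarith [hs.2]) (by positivity)))]
          refine ENNReal.ofReal_le_ofReal ?_
          have hes : 0 ≤ e t - s := by linarith [hs.2]
          have h1 : (e t - s) ^ k ≤ (e t - t) ^ k := by
            gcongr
            exact hs.1.le
          calc t ^ a / (e t - t) ^ (k + 2) * ((e t - s) ^ (k + 1) * G m s ^ 2)
              = t ^ a * ((e t - s) / (e t - t) ^ 2) * G m s ^ 2 *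
                ((e t - s) ^ k / (e t - t) ^ k) := by
                field_simp
                try ring
            _ ≤ t ^ a * ((e t - s) / (e t - t) ^ 2) * G m s ^ 2 * 1 := by
                gcongr
                exact div_le_one_of_le₀ h1 (by positivity)
            _ = _ := mul_one _
  have hinner : ∀ s, 0 < s → ∫⁻ t in U, F t s ≤
      ENNReal.ofReal C₂ * ENNReal.ofReal (s ^ a * G m s ^ 2) := by
    intro s hs
    set A := {t ∈ U | t < s ∧ s < e t} with hA
    have hk' := hker s A (fun t => e t - s) hs (fun t ht => ⟨ht.1.1, ht.2.1⟩)
      (fun t ht => sub_pos.2 ht.2.2)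
      (fun t ht t' ht' htt' => sub_le_sub_right (hemono ht.1 ht'.1 htt') s)
    calc ∫⁻ t in U, F t s
        = ∫⁻ t, U.indicator (fun t => F t s) t := (lintegral_indicator hUmeas _).symm
      _ ≤ ∫⁻ t, A.indicator (fun t => ENNReal.ofReal (t ^ a) *
          ENNReal.ofReal ((e t - s) / (e t - s + (s - t)) ^ 2) * ENNReal.ofReal (G m s ^ 2)) t := by
          refine lintegral_mono fun t => ?_
          by_cases ht : t ∈ U
          · rw [indicator_of_mem ht]
            by_cases h : t < s ∧ s < e t
            · rw [indicator_of_mem (show t ∈ A from ⟨ht, h⟩)]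
              simp only [hF]
              rw [if_pos h, sub_add_sub_cancel]
            · simp only [hF]
              rw [if_neg h]
              exact zero_le
          · rw [indicator_of_notMem ht]
            exact zero_le
      _ ≤ ∫⁻ t in A, ENNReal.ofReal (t ^ a) *
          ENNReal.ofReal ((e t - s) / (e t - s + (s - t)) ^ 2) * ENNReal.ofReal (G m s ^ 2) :=
          lintegral_indicator_le _ _
      _ ≤ ENNReal.ofReal (C₂ * s ^ a) * ENNReal.ofReal (G m s ^ 2) := by
          rw [lintegral_mul_const' _ _ ENNReal.ofReal_ne_top]
          gcongr
      _ = _ := by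
          have : 0 ≤ s ^ a := Real.rpow_nonneg hs.le _
          rw [← ENNReal.ofReal_mul (by positivity), ← ENNReal.ofReal_mul hC₂.le, mul_assoc]
  calc ∫⁻ t in Ioi 0, ENNReal.ofReal (t ^ a * |G j t| ^ p)
      ≤ ∫⁻ t in Ioi 0, U.indicator (fun t => ENNReal.ofReal (t ^ a * |G j t| ^ p)) t := by
        refine setLIntegral_mono' measurableSet_Ioi fun t ht => ?_
        by_cases htU : t ∈ U
        · rw [indicator_of_mem htU]
        · rw [hzero t ht htU, abs_zero, Real.zero_rpow hp0.ne', mul_zero, ENNReal.ofReal_zero]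
          exact zero_le
    _ ≤ ∫⁻ t in U, ENNReal.ofReal (t ^ a * |G j t| ^ p) :=
        (setLIntegral_le_lintegral _ _).trans_eq (lintegral_indicator hUmeas _)
    _ ≤ ∫⁻ t in U, ENNReal.ofReal (C₁ ^ p * M ^ (p - 2)) * ∫⁻ s in Ioi 0, F t s :=
        setLIntegral_mono' hUmeas hpt
    _ = ENNReal.ofReal (C₁ ^ p * M ^ (p - 2)) * ∫⁻ s in Ioi 0, ∫⁻ t in U, F t s := by
        rw [lintegral_const_mul' _ _ ENNReal.ofReal_ne_top, lintegral_lintegral_swap hFmeas]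
    _ ≤ ENNReal.ofReal (C₁ ^ p * M ^ (p - 2)) *
        ∫⁻ s in Ioi 0, ENNReal.ofReal C₂ * ENNReal.ofReal (s ^ a * G m s ^ 2) := by
        exact mul_le_mul_right (setLIntegral_mono' measurableSet_Ioi hinner) _
    _ = _ := by
        rw [lintegral_const_mul' _ _ ENNReal.ofReal_ne_top, ← mul_assoc,
          ← ENNReal.ofReal_mul (by positivity)]
        congr 2
        ring

section Symmetry

variable {E : Type*} [NormedAddCommGroup E] [NormedSpace ℝ E]

lemma iteratedFDeriv_succ_succ_apply {f : E → ℝ} (hf : ContDiff ℝ (⊤ : ℕ∞) f) (n : ℕ) (x : E)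
    (v : Fin (n + 2) → E) :
    iteratedFDeriv ℝ (n + 2) f x v =
      fderiv ℝ (fderiv ℝ (iteratedFDeriv ℝ n f)) x (v 0) (v 1) (Fin.tail (Fin.tail v)) := by
  have hdiff : ∀ k, ContDiff ℝ (⊤ : ℕ∞) (iteratedFDeriv ℝ k f) := fun k =>
    hf.iteratedFDeriv_right (by exact_mod_cast le_top)
  have h1 : DifferentiableAt ℝ (iteratedFDeriv ℝ (n + 1) f) x :=
    (hdiff (n + 1)).differentiable (by simp) x
  have h2 : DifferentiableAt ℝ (fderiv ℝ (iteratedFDeriv ℝ n f)) x :=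
    ((hdiff n).fderiv_right (m := (⊤ : ℕ∞)) (by exact_mod_cast le_top)).differentiable (by simp) x
  rw [h1.iteratedFDeriv_succ_apply_left']
  have h3 := ((h2.hasFDerivAt.clm_apply (hasFDerivAt_const (v 1) x))
    |>.continuousMultilinear_apply_const (Fin.tail (Fin.tail v))).fderiv
  refine (congrArg (fun L => L (v 0)) h3).trans ?_
  simp

lemma iteratedFDeriv_comp_swap {f : E → ℝ} (hf : ContDiff ℝ (⊤ : ℕ∞) f) (n : ℕ) :
    ∀ (i : Fin n) (x : E) (v : Fin (n + 1) → E),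
      iteratedFDeriv ℝ (n + 1) f x (v ∘ Equiv.swap i.castSucc i.succ) =
        iteratedFDeriv ℝ (n + 1) f x v := by
  induction n with
  | zero => exact fun i => i.elim0
  | succ n ih =>
    intro i x v
    have hdiff : ∀ k, ContDiff ℝ (⊤ : ℕ∞) (iteratedFDeriv ℝ k f) := fun k =>
      hf.iteratedFDeriv_right (by exact_mod_cast le_top)
    refine Fin.cases ?_ (fun k => ?_) i
    · rw [iteratedFDeriv_succ_succ_apply hf, iteratedFDeriv_succ_succ_apply hf]
      have hsymm : IsSymmSndFDerivAt ℝ (iteratedFDeriv ℝ n f) x :=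
        (hdiff n).contDiffAt.isSymmSndFDerivAt (by
        rw [minSmoothness_of_isRCLikeNormedField]
        exact WithTop.coe_le_coe.2 le_top)
      have h0 : (v ∘ Equiv.swap (0 : Fin (n + 1)).castSucc (0 : Fin (n + 1)).succ) 0 = v 1 := by
        simp
      have h1 : (v ∘ Equiv.swap (0 : Fin (n + 1)).castSucc (0 : Fin (n + 1)).succ) 1 = v 0 := by
        simp
      have h2 : Fin.tail (Fin.tail
          (v ∘ Equiv.swap (0 : Fin (n + 1)).castSucc (0 : Fin (n + 1)).succ)) =
          Fin.tail (Fin.tail v) := by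
        ext l
        simp only [Fin.tail, Function.comp_apply]
        rw [Equiv.swap_apply_of_ne_of_ne]
        · simp [Fin.ext_iff]
        · simp [Fin.ext_iff]
      rw [h0, h1, h2, hsymm.eq]
    · have hd : DifferentiableAt ℝ (iteratedFDeriv ℝ (n + 1) f) x :=
        (hdiff (n + 1)).differentiable (by simp) x
      rw [hd.iteratedFDeriv_succ_apply_left', hd.iteratedFDeriv_succ_apply_left']
      have h0 : (v ∘ Equiv.swap k.succ.castSucc k.succ.succ) 0 = v 0 := by
        rw [Function.comp_apply, Equiv.swap_apply_of_ne_of_ne]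
        · simp [Fin.ext_iff]
        · simp [Fin.ext_iff]
      have h1 : Fin.tail (v ∘ Equiv.swap k.succ.castSucc k.succ.succ) =
          Fin.tail v ∘ Equiv.swap k.castSucc k.succ := by
        ext l
        simp only [Fin.tail, Function.comp_apply, Fin.castSucc_succ]
        rw [← (Fin.succ_injective (n + 1)).swap_apply]
      rw [h0, h1]
      simp only [ih]

/-- The iterated derivative of a smooth function is a symmetric multilinear map. -/
lemma iteratedFDeriv_comp_perm_of_contDiff {f : E → ℝ} (hf : ContDiff ℝ (⊤ : ℕ∞) f) (n : ℕ)
    (x : E) (v : Fin n → E) (τ : Equiv.Perm (Fin n)) :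
    iteratedFDeriv ℝ n f x (v ∘ τ) = iteratedFDeriv ℝ n f x v := by
  cases n with
  | zero => congr 1; ext i; exact i.elim0
  | succ n =>
    have hτ : τ ∈ Submonoid.closure
        (Set.range fun i : Fin n => Equiv.swap i.castSucc i.succ) := by
      rw [Equiv.Perm.mclosure_swap_castSucc_succ]
      exact Submonoid.mem_top τ
    induction hτ using Submonoid.closure_induction generalizing v with
    | mem τ h =>
      obtain ⟨i, rfl⟩ := h
      exact iteratedFDeriv_comp_swap hf n i x v
    | one => rfl
    | mul τ₁ τ₂ _ _ h₁ h₂ =>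
      rw [Equiv.Perm.coe_mul, ← Function.comp_assoc, h₂, h₁]

/-- Polarization: a symmetric multilinear map is a combination of its values on the diagonal, at
points of the form `x₀ + ∑ i ∈ S, u i`. -/
lemma factorial_mul_apply_eq_sum_diagonal {n : ℕ} (T : E [×n]→L[ℝ] ℝ)
    (hT : ∀ (v : Fin n → E) (τ : Equiv.Perm (Fin n)), T (v ∘ τ) = T v) (x₀ : E) (u : Fin n → E) :
    n.factorial * T u =
      ∑ S : Finset (Fin n), (-1) ^ Sᶜ.card * T (fun _ => x₀ + ∑ i ∈ S, u i) := by
  classical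
  set w : Option (Fin n) → E := fun o => o.elim x₀ u with hw
  set c : Finset (Fin n) → Option (Fin n) → ℝ :=
    fun S o => o.elim 1 fun i => if i ∈ S then 1 else 0 with hc
  have hexp : ∀ S : Finset (Fin n), T (fun _ => x₀ + ∑ i ∈ S, u i) =
      ∑ r : Fin n → Option (Fin n), (∏ i, c S (r i)) * T (fun i => w (r i)) := by
    intro S
    have h1 : x₀ + ∑ i ∈ S, u i = ∑ o, c S o • w o := by
      rw [Fintype.sum_option]
      simp [hc, hw, ite_smul]
    rw [h1, T.map_sum (fun _ o => c S o • w o)]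
    refine Finset.sum_congr rfl fun r _ => ?_
    rw [T.map_smul_univ (fun i => c S (r i)) (fun i => w (r i)), smul_eq_mul]
  simp only [hexp, Finset.mul_sum]
  rw [Finset.sum_comm]
  have hperm : ∑ τ : Equiv.Perm (Fin n), T (u ∘ τ) = n.factorial * T u := by
    simp [hT, Fintype.card_perm]
  rw [← hperm]
  refine Fintype.sum_of_injective (fun (τ : Equiv.Perm (Fin n)) i => some (τ i)) ?_ _ _ ?_ ?_
  · intro τ τ' h
    ext i
    have := congrFun h i
    simp only [Option.some.injEq] at this
    rw [this]
  · intro r hr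
    have hk : ∃ k : Fin n, ∀ i, r i ≠ some k := by
      by_contra! hcon
      choose g hg using hcon
      have hginj : Function.Injective g := fun k l hkl => by
        have := hg k
        rw [hkl, hg l] at this
        exact (Option.some.inj this).symm
      have hgb : Function.Bijective g := Finite.injective_iff_bijective.1 hginj
      refine hr ⟨(Equiv.ofBijective g hgb).symm, ?_⟩
      funext i
      obtain ⟨k, rfl⟩ := hgb.2 i
      simp [hg]
    obtain ⟨k, hk⟩ := hk
    have hck : ∀ (S : Finset (Fin n)) i, c (symmDiff S {k}) (r i) = c S (r i) := by
      intro S i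
      rcases hri : r i with _ | l
      · rfl
      · have hlk : l ≠ k := fun h => hk i (by rw [hri, h])
        simp [hc, Finset.mem_symmDiff, hlk]
    refine Finset.sum_involution (fun S _ => symmDiff S {k}) ?_ ?_ (fun _ _ => Finset.mem_univ _)
      (fun S _ => by simp)
    · intro S _
      simp only [hck]
      by_cases hkS : k ∈ S
      · have h1 : (symmDiff S {k})ᶜ = insert k Sᶜ := by
          ext l
          by_cases h : l = k <;> simp [h, hkS]
        rw [h1, Finset.card_insert_of_notMem (by simpa using hkS)]
        ring
      · have h1 : Sᶜ = insert k (symmDiff S {k})ᶜ := by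
          ext l
          by_cases h : l = k <;> simp [h, hkS]
        rw [h1, Finset.card_insert_of_notMem (by simp [hkS])]
        ring
    · intro S _ _ h
      simp at h
  · intro τ
    have h1 : ∀ S : Finset (Fin n), S ≠ Finset.univ → ∏ i, c S (some (τ i)) = 0 := by
      intro S hS
      obtain ⟨l, hl⟩ : ∃ l, l ∉ S := by
        by_contra! h
        exact hS (Finset.eq_univ_iff_forall.2 h)
      refine Finset.prod_eq_zero (Finset.mem_univ (τ.symm l)) ?_
      simp [hc, hl]
    rw [Finset.sum_eq_single Finset.univ (fun S _ hS => by rw [h1 S hS]; ring) (by simp)]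
    simp [hc, hw, Function.comp_def]

end Symmetry

lemma norm_le_sum_abs_apply_single {ι : Type*} [Fintype ι] [DecidableEq ι] {n : ℕ}
    (T : (ι → ℝ) [×n]→L[ℝ] ℝ) :
    ‖T‖ ≤ ∑ φ : Fin n → ι, |T fun i => Pi.single (φ i) 1| := by
  refine T.opNorm_le_bound (Finset.sum_nonneg fun _ _ => abs_nonneg _) fun x => ?_
  have hx : x = fun i => ∑ k, x i k • (Pi.single k 1 : ι → ℝ) := by
    funext i
    exact pi_eq_sum_univ' (x i)
  have hT : T x = ∑ φ : Fin n → ι, T fun i => x i (φ i) • (Pi.single (φ i) 1 : ι → ℝ) := by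
    conv_lhs => rw [hx]
    exact T.map_sum fun i k => x i k • (Pi.single k 1 : ι → ℝ)
  rw [hT, Finset.sum_mul]
  refine (norm_sum_le _ _).trans (Finset.sum_le_sum fun φ _ => ?_)
  rw [T.map_smul_univ (fun i => x i (φ i)) (fun i => Pi.single (φ i) 1), norm_smul, norm_prod,
    mul_comm, Real.norm_eq_abs]
  gcongr with i
  exact norm_le_pi_norm (x i) (φ i)

lemma abs_apply_le_sum_abs_diagonal {E : Type*} [NormedAddCommGroup E] [NormedSpace ℝ E] {n : ℕ}
    (T : E [×n]→L[ℝ] ℝ) (hT : ∀ (v : Fin n → E) (τ : Equiv.Perm (Fin n)), T (v ∘ τ) = T v)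
    (x₀ : E) (u : Fin n → E) :
    |T u| ≤ ∑ S : Finset (Fin n), |T fun _ => x₀ + ∑ i ∈ S, u i| := by
  have hn : (1 : ℝ) ≤ n.factorial := by
    exact_mod_cast Nat.one_le_iff_ne_zero.2 n.factorial_ne_zero
  calc |T u| ≤ n.factorial * |T u| := le_mul_of_one_le_left (abs_nonneg _) hn
    _ = |(n.factorial : ℝ) * T u| := by rw [abs_mul, Nat.abs_cast]
    _ ≤ _ := by
      rw [factorial_mul_apply_eq_sum_diagonal T hT x₀ u]
      refine (Finset.abs_sum_le_sum_abs _ _).trans (Finset.sum_le_sum fun S _ => ?_)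
      rw [abs_mul, abs_pow, abs_neg, abs_one, one_pow, one_mul]

/-- Finitely many directions transversal to the boundary control symmetric multilinear maps. -/
lemma exists_transversal_directions (d n : ℕ) :
    ∃ (ι : Type) (_ : Fintype ι) (v : ι → Fin (d + 1) → ℝ) (K : ℝ), 0 < K ∧
      (∀ i, v i (Fin.last d) = 1) ∧
      ∀ T : (Fin (d + 1) → ℝ) [×n]→L[ℝ] ℝ,
        (∀ (u : Fin n → Fin (d + 1) → ℝ) (τ : Equiv.Perm (Fin n)), T (u ∘ τ) = T u) →
        ‖T‖ ≤ K * ∑ i, |T fun _ => v i| := by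
  let ι := (Fin n → Fin (d + 1)) × Finset (Fin n)
  obtain ⟨w, hw⟩ : ∃ w : ι → Fin (d + 1) → ℝ, ∀ q, w q =
      Pi.single (Fin.last d) 1 + ∑ i ∈ q.2, Pi.single (q.1 i) 1 := ⟨_, fun _ => rfl⟩
  have hwl : ∀ q, w q (Fin.last d) =
      1 + ∑ i ∈ q.2, (Pi.single (q.1 i) 1 : Fin (d + 1) → ℝ) (Fin.last d) := fun q => by
    rw [hw, Pi.add_apply, Finset.sum_apply, Pi.single_eq_same]
  have hb01 : ∀ i k : Fin (d + 1), 0 ≤ (Pi.single i 1 : Fin (d + 1) → ℝ) k ∧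
      (Pi.single i 1 : Fin (d + 1) → ℝ) k ≤ 1 := by
    intro i k
    rw [Pi.single_apply]
    split_ifs <;> norm_num
  have hw1 : ∀ q, 1 ≤ w q (Fin.last d) := fun q => by
    rw [hwl]
    exact le_add_of_nonneg_right (Finset.sum_nonneg fun i _ => (hb01 _ _).1)
  have hwn : ∀ q, w q (Fin.last d) ≤ n + 1 := fun q => by
    have h2 : ∑ i ∈ q.2, (Pi.single (q.1 i) 1 : Fin (d + 1) → ℝ) (Fin.last d) ≤
        ∑ i ∈ q.2, (1 : ℝ) := Finset.sum_le_sum fun i _ => (hb01 _ _).2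
    have h3 : (q.2.card : ℝ) ≤ n := by
      exact_mod_cast (Finset.card_le_univ q.2).trans_eq (Fintype.card_fin n)
    rw [Finset.sum_const, nsmul_eq_mul, mul_one] at h2
    rw [hwl]
    linarith
  refine ⟨ι, inferInstance, fun q => (w q (Fin.last d))⁻¹ • w q, (n + 1 : ℝ) ^ n, by positivity,
    fun q => ?_, fun T hT => ?_⟩
  · beta_reduce
    rw [Pi.smul_apply, smul_eq_mul, inv_mul_cancel₀ (zero_lt_one.trans_le (hw1 q)).ne']
  have hdiag : ∀ q, |T fun _ => w q| ≤
      (n + 1 : ℝ) ^ n * |T fun _ => (w q (Fin.last d))⁻¹ • w q| := by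
    intro q
    have hq := hw1 q
    have hqn := hwn q
    generalize w q (Fin.last d) = c at hq hqn
    have hc : 0 < c := zero_lt_one.trans_le hq
    have h1 : (T fun _ => w q) = c ^ n * T fun _ => c⁻¹ • w q := by
      have := T.map_smul_univ (fun _ => c) (fun _ => c⁻¹ • w q)
      simpa [smul_smul, mul_inv_cancel₀ hc.ne'] using this
    rw [h1, abs_mul, abs_of_pos (by positivity)]
    gcongr
  have hnorm : ‖T‖ ≤ ∑ q : ι, |T fun _ => w q| := by
    rw [Fintype.sum_prod_type]
    refine (norm_le_sum_abs_apply_single T).trans (Finset.sum_le_sum fun φ _ => ?_)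
    simp only [hw]
    exact abs_apply_le_sum_abs_diagonal T hT (Pi.single (Fin.last d) 1)
      (fun i => Pi.single (φ i) 1)
  rw [Finset.mul_sum]
  exact hnorm.trans (Finset.sum_le_sum fun q _ => hdiag q)

section HalfSpace

variable {d : ℕ}

lemma measurableSet_HS : MeasurableSet (HS d) :=
  measurableSet_lt measurable_const (measurable_pi_apply _)

lemma isOpen_HS : IsOpen (HS d) :=
  isOpen_lt continuous_const (continuous_apply _)

/-- Integration over the half-space by slicing it along a direction transversal to the boundary. -/
lemma lintegral_HS_eq_lintegral_halfline {F : (Fin (d + 1) → ℝ) → ℝ≥0∞} (hF : Measurable F)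
    {v : Fin (d + 1) → ℝ} (hv : v (Fin.last d) = 1) :
    ∫⁻ x in HS d, F x = ∫⁻ y : Fin d → ℝ, ∫⁻ t in Ioi (0 : ℝ),
      F ((Fin.last d).insertNth (0 : ℝ) y + t • v) := by
  let e := MeasurableEquiv.piFinSuccAbove (fun _ : Fin (d + 1) => ℝ) (Fin.last d)
  have he : MeasurePreserving e.symm (volume.prod volume) volume :=
    (volume_preserving_piFinSuccAbove (fun _ : Fin (d + 1) => ℝ) (Fin.last d)).symm e
  have hG : Measurable ((HS d).indicator F) := hF.indicator measurableSet_HS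
  have hins : ∀ (t : ℝ) (y : Fin d → ℝ), e.symm (t, y + t • (Fin.last d).removeNth v) =
      (Fin.last d).insertNth (0 : ℝ) y + t • v := by
    intro t y
    change (Fin.last d).insertNth (α := fun _ => ℝ) t (y + t • (Fin.last d).removeNth v) = _
    ext i
    refine Fin.succAboveCases (Fin.last d) ?_ (fun k => ?_) i
    · simp [hv]
    · simp [Fin.init]
  have hshear : Measurable fun z : ℝ × (Fin d → ℝ) =>
      (z.1, z.2 + z.1 • (Fin.last d).removeNth v) := by fun_prop
  calc ∫⁻ x in HS d, F x = ∫⁻ x, (HS d).indicator F x :=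
      (lintegral_indicator measurableSet_HS F).symm
    _ = ∫⁻ z, (HS d).indicator F (e.symm z) ∂(volume.prod volume) :=
      (he.lintegral_comp hG).symm
    _ = ∫⁻ t, ∫⁻ y, (HS d).indicator F (e.symm (t, y)) :=
      lintegral_prod _ (hG.comp e.symm.measurable).aemeasurable
    _ = ∫⁻ t, ∫⁻ y, (HS d).indicator F (e.symm (t, y + t • (Fin.last d).removeNth v)) := by
      refine lintegral_congr fun t => ?_
      exact (lintegral_add_right_eq_self (fun y => (HS d).indicator F (e.symm (t, y))) _).symm
    _ = ∫⁻ y, ∫⁻ t, (HS d).indicator F (e.symm (t, y + t • (Fin.last d).removeNth v)) :=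
      lintegral_lintegral_swap ((hG.comp e.symm.measurable).comp hshear).aemeasurable
    _ = _ := by
      refine lintegral_congr fun y => ?_
      rw [← lintegral_indicator measurableSet_Ioi]
      refine lintegral_congr fun t => ?_
      rw [hins]
      simp only [indicator, HS, mem_ofPred_eq, mem_Ioi]
      simp [hv]

lemma hasDerivAt_iteratedFDeriv_diagonal {E : Type*} [NormedAddCommGroup E] [NormedSpace ℝ E]
    {f : E → ℝ} (hf : ContDiff ℝ (⊤ : ℕ∞) f) (b v : E) (k : ℕ) (t : ℝ) :
    HasDerivAt (fun s : ℝ => iteratedFDeriv ℝ k f (b + s • v) fun _ => v)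
      (iteratedFDeriv ℝ (k + 1) f (b + t • v) fun _ => v) t := by
  have hd : DifferentiableAt ℝ (iteratedFDeriv ℝ k f) (b + t • v) :=
    (hf.iteratedFDeriv_right (m := (⊤ : ℕ∞)) (by exact_mod_cast le_top)).differentiable (by simp) _
  have hline : HasDerivAt (fun s : ℝ => b + s • v) v t := by
    simpa using ((hasDerivAt_id t).smul_const v).const_add b
  exact (hd.hasFDerivAt.continuousMultilinear_apply_const fun _ => v).comp_hasDerivAt t hline

lemma measurable_weight_mul {g : (Fin (d + 1) → ℝ) → ℝ} (hg : Continuous g) (a : ℝ) :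
    Measurable fun x : Fin (d + 1) → ℝ => ENNReal.ofReal (x (Fin.last d) ^ a * g x) :=
  (((measurable_pi_apply _).pow_const a).mul hg.measurable).ennreal_ofReal

lemma exists_directional_bound (d : ℕ) {a : ℝ} (ha : -1 < a) {m j : ℕ} (hj : 0 < j)
    (hjm : j < m) :
    ∃ C : ℝ, 0 < C ∧ ∀ f : (Fin (d + 1) → ℝ) → ℝ, ContDiff ℝ (⊤ : ℕ∞) f →
    ∀ v : Fin (d + 1) → ℝ, v (Fin.last d) = 1 →
    ∀ M : ℝ, 0 < M → (∀ x ∈ HS d, |f x| ≤ M) →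
    ∫⁻ x in HS d, ENNReal.ofReal (x (Fin.last d) ^ a *
        |iteratedFDeriv ℝ j f x fun _ => v| ^ (2 * (m : ℝ) / j))
      ≤ ENNReal.ofReal (C * M ^ (2 * (m : ℝ) / j - 2) * (‖v‖ ^ m) ^ 2) *
        ∫⁻ x in HS d, ENNReal.ofReal (x (Fin.last d) ^ a * ‖iteratedFDeriv ℝ m f x‖ ^ 2) := by
  obtain ⟨C, hC, hbound⟩ := exists_halfline_bound ha hj hjm
  refine ⟨C, hC, fun f hf v hv M hM hfM => ?_⟩
  have hcont : ∀ k, Continuous fun x => iteratedFDeriv ℝ k f x fun _ => v := fun k =>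
    ((hf.continuous_iteratedFDeriv (m := k) (by exact_mod_cast le_top)).eval_const _)
  have hp : 0 ≤ 2 * (m : ℝ) / j := by positivity
  have hlast : ∀ (y : Fin d → ℝ) (t : ℝ),
      ((Fin.last d).insertNth (0 : ℝ) y + t • v : Fin (d + 1) → ℝ) (Fin.last d) = t := by
    intro y t
    simp [hv]
  have hslice : ∀ g : (Fin (d + 1) → ℝ) → ℝ, Continuous g →
      ∫⁻ x in HS d, ENNReal.ofReal (x (Fin.last d) ^ a * g x) =
        ∫⁻ y : Fin d → ℝ, ∫⁻ t in Ioi (0 : ℝ),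
          ENNReal.ofReal (t ^ a * g ((Fin.last d).insertNth (0 : ℝ) y + t • v)) := fun g hg => by
    rw [lintegral_HS_eq_lintegral_halfline (measurable_weight_mul hg a) hv]
    simp only [hlast]
  have hline : ∀ y : Fin d → ℝ, ∫⁻ t in Ioi (0 : ℝ), ENNReal.ofReal (t ^ a *
        |iteratedFDeriv ℝ j f ((Fin.last d).insertNth (0 : ℝ) y + t • v) fun _ => v| ^
          (2 * (m : ℝ) / j)) ≤ ENNReal.ofReal (C * M ^ (2 * (m : ℝ) / j - 2)) *
      ∫⁻ t in Ioi (0 : ℝ), ENNReal.ofReal (t ^ a *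
        (iteratedFDeriv ℝ m f ((Fin.last d).insertNth (0 : ℝ) y + t • v) fun _ => v) ^ 2) := by
    intro y
    have hmem : ∀ s : ℝ, 0 < s →
        |f ((Fin.last d).insertNth (0 : ℝ) y + s • v)| ≤ M := fun s hs => by
      refine hfM _ ?_
      rw [HS, mem_ofPred_eq, hlast]
      exact hs
    generalize ((Fin.last d).insertNth (0 : ℝ) y : Fin (d + 1) → ℝ) = b at hmem ⊢
    exact hbound (fun k t => iteratedFDeriv ℝ k f (b + t • v) fun _ => v)
      (hasDerivAt_iteratedFDeriv_diagonal hf b v) M hM hmem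
  have hnorm : ∫⁻ x in HS d, ENNReal.ofReal (x (Fin.last d) ^ a *
        (iteratedFDeriv ℝ m f x fun _ => v) ^ 2) ≤ ENNReal.ofReal ((‖v‖ ^ m) ^ 2) *
      ∫⁻ x in HS d, ENNReal.ofReal (x (Fin.last d) ^ a * ‖iteratedFDeriv ℝ m f x‖ ^ 2) := by
    rw [← lintegral_const_mul' _ _ ENNReal.ofReal_ne_top]
    refine setLIntegral_mono' measurableSet_HS fun x hx => ?_
    have hx0 : 0 < x (Fin.last d) := hx
    rw [← ENNReal.ofReal_mul (by positivity)]
    refine ENNReal.ofReal_le_ofReal ?_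
    have h1 : |iteratedFDeriv ℝ m f x fun _ => v| ≤ ‖iteratedFDeriv ℝ m f x‖ * ‖v‖ ^ m := by
      simpa using (iteratedFDeriv ℝ m f x).le_opNorm fun _ => v
    calc x (Fin.last d) ^ a * (iteratedFDeriv ℝ m f x fun _ => v) ^ 2
        ≤ x (Fin.last d) ^ a * (‖iteratedFDeriv ℝ m f x‖ * ‖v‖ ^ m) ^ 2 := by
          rw [← sq_abs]
          gcongr
      _ = _ := by ring
  rw [hslice _ ((hcont j).abs.rpow_const fun _ => Or.inr hp)]
  refine (lintegral_mono hline).trans ?_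
  rw [lintegral_const_mul' _ _ ENNReal.ofReal_ne_top,
    ← hslice (fun x => (iteratedFDeriv ℝ m f x fun _ => v) ^ 2) ((hcont m).pow 2),
    ENNReal.ofReal_mul (q := (‖v‖ ^ m) ^ 2) (by positivity), mul_assoc]
  gcongr

/-- The interpolation inequality for the full derivatives, with the norms raised to powers. -/
lemma exists_lintegral_bound (d : ℕ) {a : ℝ} (ha : -1 < a) {m j : ℕ} (hj : 0 < j) (hjm : j < m) :
    ∃ C : ℝ, 0 < C ∧ ∀ f : (Fin (d + 1) → ℝ) → ℝ, ContDiff ℝ (⊤ : ℕ∞) f →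
    ∀ M : ℝ, 0 < M → (∀ x ∈ HS d, |f x| ≤ M) →
    ∫⁻ x in HS d, ENNReal.ofReal (x (Fin.last d) ^ a *
        ‖iteratedFDeriv ℝ j f x‖ ^ (2 * (m : ℝ) / j))
      ≤ ENNReal.ofReal (C * M ^ (2 * (m : ℝ) / j - 2)) *
        ∫⁻ x in HS d, ENNReal.ofReal (x (Fin.last d) ^ a * ‖iteratedFDeriv ℝ m f x‖ ^ (2 : ℝ)) := by
  obtain ⟨C, hC, hdir⟩ := exists_directional_bound d ha hj hjm
  obtain ⟨ι, _, v, K, hK, hv, hT⟩ := exists_transversal_directions d j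
  have hj0 : (0 : ℝ) < j := by exact_mod_cast hj
  have hp : 1 ≤ 2 * (m : ℝ) / j := by
    rw [le_div_iff₀ hj0]
    have : (j : ℝ) < m := by exact_mod_cast hjm
    linarith
  set p : ℝ := 2 * (m : ℝ) / j
  set L : ℝ := K ^ p * (Fintype.card ι : ℝ) ^ (p - 1)
  have hL : 0 ≤ L := by positivity
  refine ⟨∑ i, L * (C * (‖v i‖ ^ m) ^ 2) + 1, by positivity, fun f hf M hM hfM => ?_⟩
  simp only [Real.rpow_two]
  set I := ∫⁻ x in HS d, ENNReal.ofReal (x (Fin.last d) ^ a * ‖iteratedFDeriv ℝ m f x‖ ^ 2)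
  have hcont : ∀ i, Continuous fun x => |iteratedFDeriv ℝ j f x fun _ => v i| ^ p := fun i =>
    ((hf.continuous_iteratedFDeriv (m := j) (by exact_mod_cast le_top)).eval_const _).abs.rpow_const
      fun _ => Or.inr (zero_le_one.trans hp)
  calc _ ≤ ∫⁻ x in HS d, ∑ i, ENNReal.ofReal L * ENNReal.ofReal (x (Fin.last d) ^ a *
        |iteratedFDeriv ℝ j f x fun _ => v i| ^ p) := by
        refine setLIntegral_mono' measurableSet_HS fun x hx => ?_
        have hx0 : 0 < x (Fin.last d) := hx
        simp only [← ENNReal.ofReal_mul hL]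
        rw [← ENNReal.ofReal_sum_of_nonneg fun i _ => by positivity]
        refine ENNReal.ofReal_le_ofReal ?_
        calc x (Fin.last d) ^ a * ‖iteratedFDeriv ℝ j f x‖ ^ p
            ≤ x (Fin.last d) ^ a * (K * ∑ i, |iteratedFDeriv ℝ j f x fun _ => v i|) ^ p := by
              gcongr
              exact hT _ fun u τ => iteratedFDeriv_comp_perm_of_contDiff hf j x u τ
          _ = x (Fin.last d) ^ a * (K ^ p * (∑ i, |iteratedFDeriv ℝ j f x fun _ => v i|) ^ p) := by
              rw [Real.mul_rpow hK.le (by positivity)]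
          _ ≤ x (Fin.last d) ^ a * (K ^ p * ((Fintype.card ι : ℝ) ^ (p - 1) *
              ∑ i, |iteratedFDeriv ℝ j f x fun _ => v i| ^ p)) := by
              gcongr
              exact Real.rpow_sum_le_const_mul_sum_rpow Finset.univ _ hp
          _ = _ := by
              simp only [Finset.mul_sum]
              refine Finset.sum_congr rfl fun i _ => ?_
              ring
    _ = ∑ i, ENNReal.ofReal L * ∫⁻ x in HS d, ENNReal.ofReal (x (Fin.last d) ^ a *
        |iteratedFDeriv ℝ j f x fun _ => v i| ^ p) := by
        rw [lintegral_finsetSum _ fun i _ => (measurable_weight_mul (hcont i) a).const_mul _]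
        simp only [lintegral_const_mul' _ _ ENNReal.ofReal_ne_top]
    _ ≤ ∑ i, ENNReal.ofReal L * (ENNReal.ofReal (C * M ^ (p - 2) * (‖v i‖ ^ m) ^ 2) * I) := by
        gcongr with i
        exact hdir f hf (v i) (hv i) M hM hfM
    _ = ENNReal.ofReal ((∑ i, L * (C * (‖v i‖ ^ m) ^ 2)) * M ^ (p - 2)) * I := by
        rw [Finset.sum_mul, ENNReal.ofReal_sum_of_nonneg fun i _ => by positivity, Finset.sum_mul]
        refine Finset.sum_congr rfl fun i _ => ?_
        rw [← mul_assoc, ← ENNReal.ofReal_mul hL]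
        ring_nf
    _ ≤ _ := by
        gcongr
        exact le_add_of_nonneg_right zero_le_one

lemma wLp_ofReal_eq (σ : ℝ) {p : ℝ} (hp : 0 < p) {g : (Fin (d + 1) → ℝ) → ℝ} (hg : ∀ x, 0 ≤ g x) :
    wLp d σ (ENNReal.ofReal p) g =
      (∫⁻ x in HS d, ENNReal.ofReal (x (Fin.last d) ^ (σ * p) * g x ^ p)) ^ (1 / p) := by
  rw [wLp, eLpNorm_eq_lintegral_rpow_enorm_toReal (by simpa using hp) ENNReal.ofReal_ne_top,
    ENNReal.toReal_ofReal hp.le]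
  congr 1
  refine setLIntegral_congr_fun measurableSet_HS fun x hx => ?_
  have hx0 : 0 < x (Fin.last d) := hx
  have hx1 : 0 ≤ x (Fin.last d) ^ σ * g x := mul_nonneg (by positivity) (hg x)
  rw [Real.enorm_eq_ofReal hx1, ENNReal.ofReal_rpow_of_nonneg hx1 hp.le,
    Real.mul_rpow (by positivity) (hg x), ← Real.rpow_mul hx0.le]

lemma abs_le_eLpNorm_top_of_mem_HS {f : (Fin (d + 1) → ℝ) → ℝ} (hf : Continuous f)
    (hfin : eLpNorm f ⊤ (volume.restrict (HS d)) ≠ ⊤) {x : Fin (d + 1) → ℝ} (hx : x ∈ HS d) :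
    |f x| ≤ (eLpNorm f ⊤ (volume.restrict (HS d))).toReal := by
  set M := (eLpNorm f ⊤ (volume.restrict (HS d))).toReal
  by_contra! hcon
  have hU : IsOpen (HS d ∩ {y | M < |f y|}) :=
    isOpen_HS.inter (isOpen_lt continuous_const hf.abs)
  refine (hU.measure_pos volume ⟨x, hx, hcon⟩).ne' ?_
  have hae : ∀ᵐ y ∂(volume.restrict (HS d)), |f y| ≤ M := by
    filter_upwards [ae_le_eLpNormEssSup (f := f) (μ := volume.restrict (HS d))] with y hy
    rw [← eLpNorm_exponent_top] at hy
    rw [← Real.norm_eq_abs, ← toReal_enorm]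
    exact (ENNReal.toReal_le_toReal enorm_ne_top hfin).2 hy
  rw [ae_restrict_iff' measurableSet_HS] at hae
  refine measure_mono_null ?_ hae
  rintro y ⟨hy, hyM⟩ h
  exact (h hy).not_gt hyM

end HalfSpace

/-- **Weighted interpolation against `L^∞`** (Proposition 2.6): with `θ_j = j/m`,
`1/p_j = θ_j/2`, `σ_j = σ_m θ_j`, under `σ_m > −1/2` and `m − σ_m − d/2 > 0`, one has
`‖x_d^{σ_j} ∂^j f‖_{L^{p_j}} ≲ ‖f‖_{L^∞}^{1−θ_j} ‖x_d^{σ_m} ∂^m f‖_{L²}^{θ_j}`. -/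
theorem weighted_interpolation_Linfty
    (d m j : ℕ) (σm : ℝ)
    (hm : 2 ≤ m) (hj : 0 < j) (hjm : j < m)
    (hσm : -(1 / 2 : ℝ) < σm)
    (hmain : (m : ℝ) - σm - (d + 1 : ℝ) / 2 > 0) :
    ∃ C : ℝ, 0 < C ∧
      ∀ f : (Fin (d + 1) → ℝ) → ℝ, ContDiff ℝ (⊤ : ℕ∞) f → HasCompactSupport f →
        wLp d (σm * ((j : ℝ) / m)) (ENNReal.ofReal (2 * (m : ℝ) / j))
            (fun x => ‖iteratedFDeriv ℝ j f x‖)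
          ≤ ENNReal.ofReal C
              * eLpNorm f ⊤ (volume.restrict (HS d)) ^ (1 - (j : ℝ) / m)
              * wLp d σm 2 (fun x => ‖iteratedFDeriv ℝ m f x‖) ^ ((j : ℝ) / m) := by
  obtain ⟨C, hC, hbound⟩ := exists_lintegral_bound d (a := σm * 2) (by linarith) hj hjm
  have hj0 : (0 : ℝ) < j := by exact_mod_cast hj
  have hm0 : (0 : ℝ) < m := by exact_mod_cast hj.trans hjm
  have hp : 0 < 2 * (m : ℝ) / j := by positivity
  refine ⟨C ^ (1 / (2 * (m : ℝ) / j)), by positivity, fun f hf hfs => ?_⟩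
  have h2 : (2 : ℝ≥0∞) = ENNReal.ofReal 2 := by simp
  rw [h2, wLp_ofReal_eq _ hp fun _ => norm_nonneg _, wLp_ofReal_eq _ two_pos fun _ => norm_nonneg _,
    show σm * ((j : ℝ) / m) * (2 * (m : ℝ) / j) = σm * 2 by field_simp]
  have hfin : eLpNorm f ⊤ (volume.restrict (HS d)) ≠ ⊤ :=
    ((hf.continuous.memLp_top_of_hasCompactSupport hfs volume).restrict (HS d)).2.ne
  have hfM := fun x (hx : x ∈ HS d) => abs_le_eLpNorm_top_of_mem_HS hf.continuous hfin hx
  rw [← ENNReal.ofReal_toReal hfin]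
  set M := (eLpNorm f ⊤ (volume.restrict (HS d))).toReal
  rcases (ENNReal.toReal_nonneg : 0 ≤ M).eq_or_lt with hM | hM
  · have hzero : ∀ x ∈ HS d, iteratedFDeriv ℝ j f x = 0 := fun x hx => by
      have hev : f =ᶠ[nhds x] fun _ => (0 : ℝ) := by
        filter_upwards [isOpen_HS.mem_nhds hx] with y hy
        exact abs_nonpos_iff.1 ((hfM y hy).trans_eq hM.symm)
      rw [(hev.iteratedFDeriv ℝ j).eq_of_nhds]
      simp
    have h0 : ∫⁻ x in HS d, ENNReal.ofReal (x (Fin.last d) ^ (σm * 2) *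
        ‖iteratedFDeriv ℝ j f x‖ ^ (2 * (m : ℝ) / j)) = 0 := by
      rw [setLIntegral_congr_fun measurableSet_HS (g := fun _ => 0) fun x hx => by
        beta_reduce
        rw [hzero x hx, norm_zero, Real.zero_rpow hp.ne', mul_zero, ENNReal.ofReal_zero]]
      simp
    rw [h0, ENNReal.zero_rpow_of_pos (by positivity)]
    exact zero_le
  · have hinv : (1 : ℝ) / (2 * (m : ℝ) / j) = 1 / 2 * (j / m) := by field_simp
    have hexp : (2 * (m : ℝ) / j - 2) * (1 / (2 * (m : ℝ) / j)) = 1 - j / m := by field_simp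
    calc _ ≤ _ := ENNReal.rpow_le_rpow (hbound f hf M hM hfM) (by positivity)
      _ = _ := by
        rw [ENNReal.mul_rpow_of_nonneg _ _ (by positivity),
          ENNReal.ofReal_rpow_of_pos (by positivity), Real.mul_rpow hC.le (by positivity),
          ← Real.rpow_mul hM.le, hexp, ENNReal.ofReal_mul (by positivity),
          ENNReal.ofReal_rpow_of_pos hM, ← ENNReal.rpow_mul, hinv]
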